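/- Let n = 4. The minimal number of generators of the critical ideal C_A is at most four; indeed, there exist at most four critical binomials of I_A that generate C_A. -/

import Mathlib

open MvPolynomial Finsupp

variable (K : Type*) [Field K]

/-- The `A`-degree of an exponent vector `u ∈ ℕ^n` with respect to `a_1, …, a_n ∈ ℕ`, namely
`∑ i, u i * a i`. -/
def degN {n : ℕ} (a : Fin n → ℕ) (u : Fin n →₀ ℕ) : ℕ :=
  ∑ i, u i * a i

/-- The defining ideal `I_A` of the monomial curve `x_i = t^{a_i}`: the ideal generated by all
binomials `x^u - x^v` with `∑ u_i a_i = ∑ v_i a_i` (equivalently, the kernel of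
`k[x_1,…,x_n] → k[t]`, `x_i ↦ t^{a_i}`). -/
noncomputable def curveIdeal {n : ℕ} (a : Fin n → ℕ) : Ideal (MvPolynomial (Fin n) K) :=
  Ideal.span { f | ∃ u v : Fin n →₀ ℕ, degN a u = degN a v ∧
    f = monomial u (1 : K) - monomial v (1 : K) }

/-- `c` is the critical exponent of the variable `x_i`: the least positive integer `c` with
`c * a_i ∈ ∑_{j ≠ i} ℕ a_j`. -/
def IsCritExp {n : ℕ} (a : Fin n → ℕ) (i : Fin n) (c : ℕ) : Prop :=
  IsLeast { m : ℕ | 0 < m ∧ ∃ u : Fin n →₀ ℕ, u i = 0 ∧ m * a i = degN a u } c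

/-- `f` is a critical binomial of `I_A` with respect to `x_i` (where `c` is the vector of
critical exponents): `f = x_i^{c_i} - ∏_{j ≠ i} x_j^{u_{ij}} ∈ I_A`. -/
def IsCritBinom {n : ℕ} (a c : Fin n → ℕ) (i : Fin n) (f : MvPolynomial (Fin n) K) : Prop :=
  ∃ u : Fin n →₀ ℕ, u i = 0 ∧
    f = monomial (Finsupp.single i (c i)) (1 : K) - monomial u (1 : K) ∧
    f ∈ curveIdeal K a

/-- The critical ideal `C_A`: the ideal generated by all critical binomials of `I_A`. -/
noncomputable def criticalIdeal {n : ℕ} (a c : Fin n → ℕ) :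
    Ideal (MvPolynomial (Fin n) K) :=
  Ideal.span { f | ∃ i : Fin n, IsCritBinom K a c i f }

/-- `S` is a set of binomials generating `J`. -/
def IsBinomGenSet {σ : Type*} (J : Ideal (MvPolynomial σ K)) (S : Set (MvPolynomial σ K)) :
    Prop :=
  (∀ f ∈ S, ∃ u v : σ →₀ ℕ, f = monomial u (1 : K) - monomial v (1 : K)) ∧
  Ideal.span S = J

/-- The monomial `x^u` is an indispensable monomial of `J`: every set of binomials generating `J`
contains a binomial one of whose monomials is `x^u`. -/
def IndispMonomial {σ : Type*} (J : Ideal (MvPolynomial σ K)) (u : σ →₀ ℕ) : Prop :=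
  ∀ S : Set (MvPolynomial σ K), IsBinomGenSet K J S → ∃ f ∈ S, u ∈ f.support

/-- `f` is an indispensable binomial of `J`: every set of binomials generating `J` contains
`f` or `-f`. -/
def IndispBinomial {σ : Type*} (J : Ideal (MvPolynomial σ K)) (f : MvPolynomial σ K) : Prop :=
  ∀ S : Set (MvPolynomial σ K), IsBinomGenSet K J S → f ∈ S ∨ -f ∈ S

/-- `x^u - x^v` is a primitive binomial of `I_A`: it is a nonzero binomial of `I_A` and there is
no other nonzero binomial `x^{u'} - x^{v'} ∈ I_A` with `x^{u'} ∣ x^u` and `x^{v'} ∣ x^v`. -/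
def IsPrimitive {n : ℕ} (a : Fin n → ℕ) (u v : Fin n →₀ ℕ) : Prop :=
  u ≠ v ∧ (monomial u (1 : K) - monomial v (1 : K)) ∈ curveIdeal K a ∧
  ∀ u' v' : Fin n →₀ ℕ, u' ≤ u → v' ≤ v → u' ≠ v' →
    (monomial u' (1 : K) - monomial v' (1 : K)) ∈ curveIdeal K a → u' = u ∧ v' = v

theorem degN_add {n : ℕ} (a : Fin n → ℕ) (u v : Fin n →₀ ℕ) :
    degN a (u + v) = degN a u + degN a v := by
  simp [degN, add_mul, Finset.sum_add_distrib]

theorem degN_single {n : ℕ} (a : Fin n → ℕ) (i : Fin n) (m : ℕ) :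
    degN a (single i m) = m * a i := by
  simp [degN, Finsupp.single_apply, ite_mul]

theorem mul_le_degN {n : ℕ} (a : Fin n → ℕ) (u : Fin n →₀ ℕ) (i : Fin n) :
    u i * a i ≤ degN a u :=
  Finset.single_le_sum (f := fun i => u i * a i) (fun _ _ => Nat.zero_le _) (Finset.mem_univ i)

theorem degN_pos {n : ℕ} {a : Fin n → ℕ} (ha : ∀ i, 0 < a i) {u : Fin n →₀ ℕ} (hu : u ≠ 0) :
    0 < degN a u := by
  obtain ⟨i, hi⟩ := Finsupp.ne_iff.mp hu
  exact (Nat.mul_pos (Nat.pos_of_ne_zero hi) (ha i)).trans_le (mul_le_degN a u i)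

theorem ne_zero_of_degN_pos {n : ℕ} {a : Fin n → ℕ} {u : Fin n →₀ ℕ} (hu : 0 < degN a u) :
    u ≠ 0 := by
  rintro rfl
  simp [degN] at hu

/-- A binomial of the curve ideal is homogeneous for the `A`-grading. -/
theorem degN_eq_of_mem_curveIdeal {n : ℕ} {a : Fin n → ℕ} {u v : Fin n →₀ ℕ}
    (h : (monomial u (1 : K) - monomial v (1 : K)) ∈ curveIdeal K a) :
    degN a u = degN a v := by
  let φ : MvPolynomial (Fin n) K →ₐ[K] Polynomial K := aeval fun i => Polynomial.X ^ a i
  have hφ (w : Fin n →₀ ℕ) : φ (monomial w 1) = Polynomial.X ^ degN a w := by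
    simp only [φ, aeval_monomial, map_one, one_mul, degN]
    rw [Finsupp.prod_fintype _ _ (by simp), ← Finset.prod_pow_eq_pow_sum]
    exact Finset.prod_congr rfl fun i _ => by rw [← pow_mul, mul_comm]
  have hle : curveIdeal K a ≤ RingHom.ker φ := by
    rw [curveIdeal, Ideal.span_le]
    rintro f ⟨p, q, hpq, rfl⟩
    simp [RingHom.mem_ker, hφ, hpq]
  have h0 := hle h
  rw [RingHom.mem_ker, map_sub, hφ, hφ, sub_eq_zero] at h0
  simpa using congrArg Polynomial.natDegree h0

/-- The additive congruence on exponent vectors identifying `u` and `v` when `x^u - x^v ∈ J`. -/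
def binomialCon {σ : Type*} (J : Ideal (MvPolynomial σ K)) : AddCon (σ →₀ ℕ) where
  r u v := (monomial u (1 : K) - monomial v (1 : K)) ∈ J
  iseqv :=
    { refl := fun u => by simp
      symm := fun {u v} h => by simpa using J.neg_mem h
      trans := fun {u v w} h₁ h₂ => by simpa using J.add_mem h₁ h₂ }
  add' := fun {u v w z} h₁ h₂ => by
    have h := J.add_mem (J.mul_mem_right (monomial w 1) h₁) (J.mul_mem_left (monomial v 1) h₂)
    simpa [sub_mul, mul_sub, monomial_mul] using h

theorem IsCritExp.le {n : ℕ} {a : Fin n → ℕ} {i : Fin n} {c : ℕ} (h : IsCritExp a i c)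
    {m : ℕ} (hm : 0 < m) {u : Fin n →₀ ℕ} (hu : u i = 0) (hd : m * a i = degN a u) : c ≤ m :=
  h.2 ⟨hm, u, hu, hd⟩

theorem IsCritExp.pos {n : ℕ} {a : Fin n → ℕ} {i : Fin n} {c : ℕ} (h : IsCritExp a i c) :
    0 < c :=
  h.1.1

/-- A monomial in the fibre of `x_i^c` other than `x_i^c` itself does not involve `x_i`. -/
theorem IsCritExp.apply_eq_zero {n : ℕ} {a : Fin n → ℕ} (ha : ∀ i, 0 < a i) {i : Fin n} {c : ℕ}
    (h : IsCritExp a i c) {u : Fin n →₀ ℕ} (hd : degN a u = c * a i) (hu : u ≠ single i c) :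
    u i = 0 := by
  by_contra hi
  have hsplit : single i (u i) + u.erase i = u := Finsupp.single_add_erase i u
  have hdeg : u i * a i + degN a (u.erase i) = c * a i := by
    rw [← hd, ← degN_single, ← degN_add, hsplit]
  have hle : u i ≤ c := Nat.le_of_mul_le_mul_right (by omega) (ha i)
  rcases hle.eq_or_lt with heq | hlt
  · have h0 : u.erase i = 0 := by
      by_contra hne
      have := degN_pos ha hne
      rw [heq] at hdeg
      omega
    rw [h0, add_zero, heq] at hsplit
    exact hu hsplit.symm
  · have := h.le (m := c - u i) (by omega) (u := u.erase i) (by simp)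
      (by rw [Nat.sub_mul]; omega)
    omega

/-- A congruence containing one relation `x_s^{c_s} ~ x^{w s}` for every variable, such that
critical powers of equal degree are related, and related to some monomial that is not a critical
power whenever their fibre contains one, identifies all monomials in each critical fibre. -/
theorem rel_of_degN_eq_crit {a c : Fin 4 → ℕ} (ha : ∀ i, 0 < a i)
    (hc : ∀ i, IsCritExp a i (c i)) (r : AddCon (Fin 4 →₀ ℕ)) (w : Fin 4 → Fin 4 →₀ ℕ)
    (hw : ∀ s, w s s = 0) (hwd : ∀ s, degN a (w s) = c s * a s)
    (hwr : ∀ s, r (single s (c s)) (w s))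
    (hcrit : ∀ s t, c s * a s = c t * a t → r (single s (c s)) (single t (c t)))
    (hnon : ∀ s u, degN a u = c s * a s → (∀ t, u ≠ single t (c t)) →
      ∃ v, degN a v = c s * a s ∧ (∀ t, v ≠ single t (c t)) ∧ r (single s (c s)) v)
    (i : Fin 4) (e : ℕ) :
    ∀ g : Fin 4 →₀ ℕ, g i = 0 → degN a g + e = c i * a i →
      ∀ u v, degN a u = e → degN a v = e → r u v := by
  induction e using Nat.strong_induction_on with
  | _ e ih =>
  intro g hgi hg
  have free : ∀ u, degN a u = e → u ≠ single i (c i) → u i = 0 := by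
    intro u hu hne
    have := (hc i).apply_eq_zero ha (u := g + u) (by rw [degN_add, hu, hg]) (by
      intro heq
      have h1 : g = 0 := by
        ext s
        by_cases hs : s = i
        · simp [hs, hgi]
        · have := DFunLike.congr_fun heq s
          simp [Ne.symm hs] at this
          simp [this.1]
      rw [h1, zero_add] at heq
      exact hne heq)
    simpa [hgi] using this
  have share : ∀ u v s, degN a u = e → degN a v = e → s ≠ i → u s ≠ 0 → v s ≠ 0 → r u v := by
    intro u v s hu hv hsi hus hvs
    have split : ∀ z : Fin 4 →₀ ℕ, z s ≠ 0 → single s 1 + (z - single s 1) = z := by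
      intro z hz
      refine add_tsub_cancel_of_le ?_
      rw [Finsupp.single_le_iff]
      omega
    have hdu := degN_add a (single s 1) (u - single s 1)
    have hdv := degN_add a (single s 1) (v - single s 1)
    rw [split u hus, degN_single, one_mul] at hdu
    rw [split v hvs, degN_single, one_mul] at hdv
    have hs := ha s
    have := ih (e - a s) (by omega) (g + single s 1) (by simp [hgi, hsi])
      (by rw [degN_add, degN_single]; omega) (u - single s 1) (v - single s 1)
      (by omega) (by omega)
    have := r.add (r.refl (single s 1)) this
    rwa [split u hus, split v hvs] at this
  -- Replacing `x_j^{c_j}` inside a higher power of `x_j`.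
  have step : ∀ j m, j ≠ i → degN a (single j m) = e → c j < m →
      degN a (single j (m - c j) + w j) = e ∧ w j i = 0 ∧
        r (single j m) (single j (m - c j) + w j) := by
    intro j m hji hd hm
    have hd' : degN a (single j (m - c j) + w j) = e := by
      rw [degN_add, degN_single, hwd, ← Nat.add_mul, Nat.sub_add_cancel hm.le, ← degN_single, hd]
    refine ⟨hd', ?_, ?_⟩
    · have := free _ hd' (by
        intro heq
        have := DFunLike.congr_fun heq j
        simp [hw, hji.symm] at this
        omega)
      simpa [Finsupp.single_apply, hji] using this
    · have := r.add (r.refl (single j (m - c j))) (hwr j)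
      rwa [← Finsupp.single_add, Nat.sub_add_cancel hm.le] at this
  have lt_exp : ∀ j m u, degN a (single j m) = e → degN a u = e → u j = 0 → m ≠ 0 →
      single j m ≠ single j (c j) → c j < m := by
    intro j m u hj hu huj hm hne
    have := (hc j).le (Nat.pos_of_ne_zero hm) huj (by rw [← degN_single, hj, hu])
    refine lt_of_le_of_ne this ?_
    rintro rfl
    exact hne rfl
  have w_ne : ∀ s, w s ≠ 0 := fun s =>
    ne_zero_of_degN_pos (a := a) (by rw [hwd]; exact Nat.mul_pos (hc s).pos (ha s))
  have of_pure : ∀ j m v, degN a (single j m) = e → degN a v = e → single j m ≠ 0 → v ≠ 0 →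
      (∀ t, single j m ≠ single t (c t)) → (∀ t, v ≠ single t (c t)) → v j = 0 → r (single j m) v := by
    intro j m v hj hv hj0 hv0 hnj hnv hvj
    have hm : m ≠ 0 := by rintro rfl; simp at hj0
    have hji : j ≠ i := by
      rintro rfl
      have := free _ hj (hnj j)
      simp at this
      exact hm this
    have hvi := free v hv (hnv i)
    have hlt := lt_exp j m v hj hv hvj hm (hnj j)
    obtain ⟨hyd, hwi, hyr⟩ := step j m hji hj hlt
    by_cases hmeet : ∃ s, w j s ≠ 0 ∧ v s ≠ 0
    · obtain ⟨s, hs, hvs⟩ := hmeet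
      refine r.trans hyr (share _ _ s hyd hv ?_ (by simp [hs]) hvs)
      rintro rfl
      exact hvs hvi
    push Not at hmeet
    obtain ⟨p, hp⟩ := Finsupp.ne_iff.mp (w_ne j)
    obtain ⟨l, hl⟩ := Finsupp.ne_iff.mp hv0
    simp only [Finsupp.coe_zero, Pi.zero_apply] at hp hl
    have hpl : p ≠ l := by rintro rfl; exact hl (hmeet p hp)
    have hpi : p ≠ i := by rintro rfl; exact hp hwi
    have hpj : p ≠ j := by rintro rfl; exact hp (hw p)
    have hli : l ≠ i := by rintro rfl; exact hl hvi
    have hlj : l ≠ j := by rintro rfl; exact hl hvj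
    have cover : ∀ t, t = i ∨ t = j ∨ t = l ∨ t = p := by
      revert hpl hpi hpj hli hlj hji
      clear * -
      revert i j l p
      decide
    obtain ⟨q, rfl⟩ : ∃ q, v = single l q := by
      refine ⟨v l, ?_⟩
      ext t
      rcases cover t with rfl | rfl | rfl | rfl
      · simp [hvi, hli]
      · simp [hvj, hlj]
      · simp
      · simp [hmeet _ hp, hpl.symm]
    have hq : q ≠ 0 := by simpa using hl
    have hlt' := lt_exp l q (single j m) hv hj (by simp [hlj.symm]) hq (hnv l)
    obtain ⟨hyd', hwi', hyr'⟩ := step l q hli hv hlt'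
    obtain ⟨t, ht⟩ := Finsupp.ne_iff.mp (w_ne l)
    simp only [Finsupp.coe_zero, Pi.zero_apply] at ht
    rcases cover t with rfl | rfl | rfl | rfl
    · exact absurd hwi' ht
    · exact r.trans (share _ _ t hj hyd' hji (by simpa using hm) (by simp [ht])) (r.symm hyr')
    · exact absurd (hw _) ht
    · exact r.trans hyr (r.trans (share _ _ t hyd hyd' hpi (by simp [hp]) (by simp [ht]))
        (r.symm hyr'))
  have noncrit : ∀ u v, degN a u = e → degN a v = e → (∀ t, u ≠ single t (c t)) →
      (∀ t, v ≠ single t (c t)) → r u v := by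
    intro u v hu hv hnu hnv
    rcases Nat.eq_zero_or_pos e with rfl | he
    · have hz : ∀ z, degN a z = 0 → z = 0 := fun z hz => by
        by_contra h
        exact (degN_pos ha h).ne' hz
      rw [hz u hu, hz v hv]
      exact r.refl 0
    have hu0 : u ≠ 0 := ne_zero_of_degN_pos (a := a) (by omega)
    have hv0 : v ≠ 0 := ne_zero_of_degN_pos (a := a) (by omega)
    have hui := free u hu (hnu i)
    have hvi := free v hv (hnv i)
    by_cases hmeet : ∃ s, u s ≠ 0 ∧ v s ≠ 0
    · obtain ⟨s, hus, hvs⟩ := hmeet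
      refine share u v s hu hv ?_ hus hvs
      rintro rfl
      exact hvs hvi
    push Not at hmeet
    have hdisj : Disjoint u.support v.support := by
      rw [Finset.disjoint_left]
      intro s hs hs'
      exact (Finsupp.mem_support_iff.mp hs') (hmeet s (Finsupp.mem_support_iff.mp hs))
    have hcard : u.support.card + v.support.card ≤ 3 := by
      rw [← Finset.card_union_of_disjoint hdisj]
      calc _ ≤ (Finset.univ.erase i).card := Finset.card_le_card (by
            intro s hs
            simp only [Finset.mem_union, Finsupp.mem_support_iff] at hs
            simp only [Finset.mem_erase, Finset.mem_univ, and_true]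
            rintro rfl
            tauto)
        _ = 3 := by simp
    rcases (by omega : u.support.card ≤ 1 ∨ v.support.card ≤ 1) with h | h
    · obtain ⟨j, m, rfl⟩ := Finsupp.card_support_le_one'.mp h
      have hm : m ≠ 0 := by rintro rfl; simp at hu0
      exact of_pure j m v hu hv hu0 hv0 hnu hnv (hmeet j (by simpa using hm))
    · obtain ⟨j, m, rfl⟩ := Finsupp.card_support_le_one'.mp h
      have hm : m ≠ 0 := by rintro rfl; simp at hv0
      refine r.symm (of_pure j m u hv hu hv0 hu0 hnv hnu ?_)
      by_contra huj
      have := hmeet j huj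
      simp at this
      exact hm this
  have mixed : ∀ s v, degN a (single s (c s)) = e → degN a v = e → (∀ t, v ≠ single t (c t)) →
      r (single s (c s)) v := by
    intro s v hs hv hnv
    have hds : c s * a s = e := by rw [← degN_single, hs]
    obtain ⟨z, hz, hnz, hrz⟩ := hnon s v (hv.trans hds.symm) hnv
    exact r.trans hrz (noncrit z v (hz.trans hds) hv hnz hnv)
  intro u v hu hv
  by_cases hnu : ∀ t, u ≠ single t (c t)
  · by_cases hnv : ∀ t, v ≠ single t (c t)
    · exact noncrit u v hu hv hnu hnv
    · push Not at hnv
      obtain ⟨t, rfl⟩ := hnv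
      exact r.symm (mixed t u hv hu hnu)
  · push Not at hnu
    obtain ⟨s, rfl⟩ := hnu
    by_cases hnv : ∀ t, v ≠ single t (c t)
    · exact mixed s v hu hv hnv
    · push Not at hnv
      obtain ⟨t, rfl⟩ := hnv
      exact hcrit s t (by rw [← degN_single, ← degN_single, hu, hv])

/-- A choice of one critical relation per variable linking every critical power to the critical
power of a representative of its degree class, and the representative to a monomial that is not
a critical power whenever its fibre contains one. -/
theorem exists_critical_choice {n : ℕ} {a c : Fin n → ℕ} (ha : ∀ i, 0 < a i)
    (hc : ∀ i, IsCritExp a i (c i)) :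
    ∃ (root : Fin n → Fin n) (w : Fin n → Fin n →₀ ℕ),
      (∀ s, c (root s) * a (root s) = c s * a s) ∧
      (∀ s t, c s * a s = c t * a t → root s = root t) ∧
      (∀ s, w s s = 0) ∧ (∀ s, degN a (w s) = c s * a s) ∧
      (∀ s, root s ≠ s → w s = single (root s) (c (root s))) ∧
      (∀ s, root s = s → (∃ u, degN a u = c s * a s ∧ ∀ t, u ≠ single t (c t)) →
        ∀ t, w s ≠ single t (c t)) := by
  classical
  let d : Fin n → ℕ := fun s => c s * a s
  let rep : ℕ → Fin n → Fin n := fun e s => if h : ∃ t, d t = e then h.choose else s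
  have hrep : ∀ s, d (rep (d s) s) = d s := fun s => by
    have h : ∃ t, d t = d s := ⟨s, rfl⟩
    simp only [rep, dif_pos h]
    exact h.choose_spec
  have hroot : ∀ s t, d s = d t → rep (d s) s = rep (d t) t := fun s t hst => by
    have h : ∃ z, d z = d t := ⟨t, rfl⟩
    simp only [rep, hst, dif_pos h]
  have key : ∀ s, ∃ u : Fin n →₀ ℕ, u s = 0 ∧ degN a u = d s ∧
      (rep (d s) s ≠ s → u = single (rep (d s) s) (c (rep (d s) s))) ∧
      (rep (d s) s = s → (∃ v, degN a v = d s ∧ ∀ t, v ≠ single t (c t)) →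
        ∀ t, u ≠ single t (c t)) := by
    intro s
    by_cases hs : rep (d s) s = s
    · by_cases hv : ∃ v, degN a v = d s ∧ ∀ t, v ≠ single t (c t)
      · obtain ⟨v, hvd, hvn⟩ := hv
        exact ⟨v, (hc s).apply_eq_zero ha hvd (hvn s), hvd, fun h => absurd hs h,
          fun _ _ => hvn⟩
      · obtain ⟨u, hu, hd⟩ := (hc s).1.2
        exact ⟨u, hu, hd.symm, fun h => absurd hs h, fun _ h => absurd h hv⟩
    · exact ⟨single (rep (d s) s) (c (rep (d s) s)), by simp [hs],
        by rw [degN_single]; exact hrep s, fun _ => rfl, fun h => absurd h hs⟩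
  choose w h₁ h₂ h₃ h₄ using key
  exact ⟨fun s => rep (d s) s, w, hrep, hroot, h₁, h₂, h₃, h₄⟩

/-- For `n = 4`, the minimal number of generators of the critical ideal `C_A`
is at most four: there exist at most four critical binomials of `I_A` generating `C_A`. -/
theorem statement18 (a c : Fin 4 → ℕ) (ha : ∀ i, 0 < a i)
    (hgcd : Finset.univ.gcd a = 1) (hc : ∀ i, IsCritExp a i (c i)) :
    ∃ S : Finset (MvPolynomial (Fin 4) K), S.card ≤ 4 ∧
      (∀ f ∈ S, ∃ i : Fin 4, IsCritBinom K a c i f) ∧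
      criticalIdeal K a c = Ideal.span (S : Set (MvPolynomial (Fin 4) K)) := by
  classical
  obtain ⟨root, w, hrd, hreq, hw, hwd, hwroot, hwnon⟩ := exists_critical_choice ha hc
  let f : Fin 4 → MvPolynomial (Fin 4) K := fun s =>
    monomial (single s (c s)) 1 - monomial (w s) 1
  have hf : ∀ s, IsCritBinom K a c s (f s) := fun s =>
    ⟨w s, hw s, rfl, Ideal.subset_span ⟨_, _, by rw [degN_single, hwd], rfl⟩⟩
  refine ⟨Finset.univ.image f, Finset.card_image_le, ?_, le_antisymm ?_ ?_⟩
  · intro g hg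
    obtain ⟨s, -, rfl⟩ := Finset.mem_image.mp hg
    exact ⟨s, hf s⟩
  · let r := binomialCon K (Ideal.span (Finset.univ.image f : Set (MvPolynomial (Fin 4) K)))
    have hwr : ∀ s, r (single s (c s)) (w s) := fun s =>
      Ideal.subset_span (by simp [f])
    have hr : ∀ s, r (single s (c s)) (single (root s) (c (root s))) := by
      intro s
      by_cases hs : root s = s
      · rw [hs]
        exact r.refl _
      · simpa [← hwroot s hs] using hwr s
    refine Ideal.span_le.mpr ?_
    rintro _ ⟨i, u, -, rfl, hu⟩
    refine rel_of_degN_eq_crit ha hc r w hw hwd hwr ?_ ?_ i (c i * a i) 0 rfl (by simp [degN])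
      (single i (c i)) u (degN_single a i _) ?_
    · intro s t hst
      have h := hr s
      rw [hreq s t hst] at h
      exact r.trans h (r.symm (hr t))
    · intro s v hv hnv
      have hrr : root (root s) = root s := hreq _ _ (hrd s)
      refine ⟨w (root s), by rw [hwd, hrd], hwnon _ hrr ⟨v, by rw [hrd, hv], hnv⟩, ?_⟩
      exact r.trans (hr s) (hwr _)
    · rw [← degN_eq_of_mem_curveIdeal K hu, degN_single]
  · refine Ideal.span_mono ?_
    intro g hg
    obtain ⟨s, -, rfl⟩ := Finset.mem_image.mp (Finset.mem_coe.mp hg)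
    exact ⟨s, hf s⟩
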